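/- arXiv:1902.08074 — 2 statements merged into one kernel-verified Lean document; each statement's English description precedes it below -/
import Mathlib

section
/- (Proposition 2.1, first part) Let g : ℝⁿ → ℝⁿ be a homeomorphism, Q ⊆ ℝⁿ a compact set, and let A_Q = ⋂_{j≥0} g^j(Q) be the global attractor relative to Q. Suppose the sequence 𝓑₀, 𝓑₁, 𝓑₂, … is generated by the subdivision scheme with contraction factor 0 < θ < 1, and set Q_k = ⋃_{B ∈ 𝓑_k} B. Then the sets Q_k contain the relative global attractor: A_Q ⊆ Q_k for all k = 0, 1, 2, …. -/
/-- The sequence of finite collections `𝓑 k` of nonempty compact subsets of `ℝⁿ` is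
generated by the subdivision scheme for the homeomorphism `g`, the compact set `Q` and
the contraction factor `θ` if:
(i) `⋃_{B ∈ 𝓑 0} B = Q`;
(ii) for each `k` there is a finite collection `𝓑̂` of nonempty compact sets with
`⋃_{B ∈ 𝓑̂} B = ⋃_{B ∈ 𝓑 k} B` and `max_{B ∈ 𝓑̂} diam B ≤ θ · max_{B ∈ 𝓑 k} diam B`;
(iii) `𝓑 (k+1) = {B ∈ 𝓑̂ : ∃ B̂ ∈ 𝓑̂, g⁻¹(B) ∩ B̂ ≠ ∅}`. -/
def IsSubdivisionScheme {n : ℕ} (g : (Fin n → ℝ) ≃ₜ (Fin n → ℝ))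
    (Q : Set (Fin n → ℝ)) (θ : ℝ) (𝓑 : ℕ → Finset (Set (Fin n → ℝ))) : Prop :=
  (∀ k, ∀ B ∈ 𝓑 k, B.Nonempty ∧ IsCompact B) ∧
  (⋃₀ ((𝓑 0 : Finset (Set (Fin n → ℝ))) : Set (Set (Fin n → ℝ))) = Q) ∧
  (∀ k : ℕ, ∃ 𝓑hat : Finset (Set (Fin n → ℝ)),
    (∀ B ∈ 𝓑hat, B.Nonempty ∧ IsCompact B) ∧
    (⋃₀ (𝓑hat : Set (Set (Fin n → ℝ))) = ⋃₀ ((𝓑 k : Finset (Set (Fin n → ℝ))) : Set (Set (Fin n → ℝ)))) ∧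
    (sSup (Metric.diam '' (𝓑hat : Set (Set (Fin n → ℝ)))) ≤ θ * sSup (Metric.diam '' ((𝓑 k : Finset (Set (Fin n → ℝ))) : Set (Set (Fin n → ℝ))))) ∧
    ((↑(𝓑 (k + 1)) : Set (Set (Fin n → ℝ))) =
      {B ∈ (↑𝓑hat : Set (Set (Fin n → ℝ))) |
        ∃ Bhat ∈ (↑𝓑hat : Set (Set (Fin n → ℝ))), ((⇑g) ⁻¹' B ∩ Bhat).Nonempty}))

/-- The relative attractor `⋂ j, g^j(Q)` is mapped into itself by `g⁻¹`. -/
theorem symm_mem_iInter_iterate_image {X : Type*} [TopologicalSpace X] (g : X ≃ₜ X)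
    (Q : Set X) {x : X} (hx : x ∈ ⋂ j : ℕ, (⇑g)^[j] '' Q) :
    g.symm x ∈ ⋂ j : ℕ, (⇑g)^[j] '' Q := by
  refine Set.mem_iInter.2 fun j => ?_
  obtain ⟨q, hq, rfl⟩ := Set.mem_iInter.1 hx (j + 1)
  exact ⟨q, hq, by rw [Function.iterate_succ_apply', g.symm_apply_apply]⟩

/-- Proposition 2.1, first part: For a homeomorphism `g` of `ℝⁿ`, a
compact set `Q`, and collections `𝓑 k` generated by the subdivision scheme with
contraction factor `0 < θ < 1`, the sets `Q_k = ⋃_{B ∈ 𝓑 k} B` contain the global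
attractor relative to `Q`: `A_Q = ⋂_{j ≥ 0} g^j(Q) ⊆ Q_k` for all `k`. -/
theorem relative_attractor_subset_subdivision {n : ℕ}
    (g : (Fin n → ℝ) ≃ₜ (Fin n → ℝ)) (Q : Set (Fin n → ℝ)) (θ : ℝ)
    (hθ₀ : 0 < θ) (hθ₁ : θ < 1) (hQ : IsCompact Q)
    (𝓑 : ℕ → Finset (Set (Fin n → ℝ)))
    (h𝓑 : IsSubdivisionScheme g Q θ 𝓑) :
    ∀ k : ℕ, (⋂ j : ℕ, (⇑g)^[j] '' Q) ⊆
      ⋃₀ ((𝓑 k : Finset (Set (Fin n → ℝ))) : Set (Set (Fin n → ℝ))) := by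
  obtain ⟨-, h₀, hstep⟩ := h𝓑
  intro k
  induction k with
  | zero =>
    intro x hx
    rw [h₀]
    simpa using Set.mem_iInter.1 hx 0
  | succ k ih =>
    intro x hx
    obtain ⟨𝓑hat, -, hcover, -, hsel⟩ := hstep k
    rw [← hcover] at ih
    obtain ⟨B, hB, hxB⟩ := ih hx
    obtain ⟨C, hC, hxC⟩ := ih (symm_mem_iInter_iterate_image g Q hx)
    rw [hsel]
    exact ⟨B, ⟨hB, C, hC, g.symm x, by simpa using hxB, hxC⟩, hxB⟩
end

section
/- (Proposition 2.3) Let f : ℝⁿ → ℝⁿ be a homeomorphism with compact global attractor A ⊆ ℝⁿ. Let Q¹, Q² ⊆ ℝⁿ be compact sets with A ⊆ Q¹ ⊆ Q², and for i = 1, 2 suppose the sequence 𝓑₀ⁱ, 𝓑₁ⁱ, 𝓑₂ⁱ, … is generated by the subdivision scheme for f applied with initial compact set Qⁱ and a contraction factor 0 < θᵢ < 1, with corresponding sets Q_kⁱ = ⋃_{B ∈ 𝓑_kⁱ} B. Then lim_{k→∞} h(Q_k¹, Q_k²) = 0, where h denotes the Hausdorff distance between compact subsets of ℝⁿ. -/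
/-- A nonempty compact set `A ⊆ ℝⁿ` is the compact global attractor of a homeomorphism
`f` if `f(A) = A` and `A` attracts every bounded set: for every bounded `B` and every
`ε > 0` there is `N` such that `f^j(B) ⊆ U_ε(A)` for all `j ≥ N`. -/
def IsGlobalAttractor {n : ℕ} (f : (Fin n → ℝ) ≃ₜ (Fin n → ℝ))
    (A : Set (Fin n → ℝ)) : Prop :=
  A.Nonempty ∧ IsCompact A ∧ (⇑f) '' A = A ∧
    ∀ B : Set (Fin n → ℝ), Bornology.IsBounded B → ∀ ε > (0 : ℝ), ∃ N : ℕ,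
      ∀ j ≥ N, (⇑f)^[j] '' B ⊆ Metric.thickening ε A

namespace IsSubdivisionScheme

variable {n : ℕ} {f : (Fin n → ℝ) ≃ₜ (Fin n → ℝ)} {A Q : Set (Fin n → ℝ)} {θ : ℝ}
  {𝓑 : ℕ → Finset (Set (Fin n → ℝ))}

/-- The union of the boxes of the `k`-th covering. -/
def cover (𝓑 : ℕ → Finset (Set (Fin n → ℝ))) (k : ℕ) : Set (Fin n → ℝ) :=
  ⋃₀ ((𝓑 k : Finset (Set (Fin n → ℝ))) : Set (Set (Fin n → ℝ)))

/-- The maximal diameter of the boxes of the `k`-th covering. -/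
noncomputable def mesh (𝓑 : ℕ → Finset (Set (Fin n → ℝ))) (k : ℕ) : ℝ :=
  sSup (Metric.diam '' ((𝓑 k : Finset (Set (Fin n → ℝ))) : Set (Set (Fin n → ℝ))))

lemma isCompact_cover (h : IsSubdivisionScheme f Q θ 𝓑) (k : ℕ) : IsCompact (cover 𝓑 k) :=
  (𝓑 k).finite_toSet.isCompact_sUnion fun B hB => (h.1 k B hB).2

lemma cover_antitone (h : IsSubdivisionScheme f Q θ 𝓑) : Antitone (cover 𝓑) := by
  refine antitone_nat_of_succ_le fun k => ?_
  obtain ⟨C, -, hU, -, hB⟩ := h.2.2 k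
  unfold cover
  rw [hB, ← hU]
  exact Set.sUnion_subset_sUnion fun B h => h.1

lemma subset_cover (h : IsSubdivisionScheme f Q θ 𝓑) (hA : f '' A = A) (hAQ : A ⊆ Q) (k : ℕ) :
    A ⊆ cover 𝓑 k := by
  induction k with
  | zero => exact hAQ.trans h.2.1.superset
  | succ k ih =>
    obtain ⟨C, -, hU, -, hB⟩ := h.2.2 k
    intro x hx
    obtain ⟨y, hy, rfl⟩ := hA.superset hx
    obtain ⟨B, hBC, hxB⟩ := hU.superset (ih hx)
    obtain ⟨B', hBC', hyB⟩ := hU.superset (ih hy)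
    exact ⟨B, hB.superset ⟨hBC, B', hBC', y, hxB, hyB⟩, hxB⟩

lemma diam_le_mesh {B : Set (Fin n → ℝ)} {k : ℕ} (hB : B ∈ 𝓑 k) : Metric.diam B ≤ mesh 𝓑 k :=
  le_csSup ((𝓑 k).finite_toSet.image _).bddAbove ⟨B, hB, rfl⟩

lemma mesh_nonneg (k : ℕ) : 0 ≤ mesh 𝓑 k := by
  refine Real.sSup_nonneg ?_
  rintro _ ⟨B, -, rfl⟩
  exact Metric.diam_nonneg

lemma mesh_succ_le (h : IsSubdivisionScheme f Q θ 𝓑) (k : ℕ)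
    (hne : (cover 𝓑 (k + 1)).Nonempty) : mesh 𝓑 (k + 1) ≤ θ * mesh 𝓑 k := by
  obtain ⟨C, -, -, hd, hB⟩ := h.2.2 k
  refine le_trans ?_ hd
  obtain ⟨x, B, hBk, -⟩ := hne
  refine csSup_le_csSup (C.finite_toSet.image _).bddAbove ⟨_, B, hBk, rfl⟩ ?_
  rw [hB]
  exact Set.image_mono fun B h => h.1

lemma tendsto_mesh (h : IsSubdivisionScheme f Q θ 𝓑) (hθ : 0 < θ ∧ θ < 1)
    (hne : ∀ k, (cover 𝓑 k).Nonempty) :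
    Filter.Tendsto (mesh 𝓑) Filter.atTop (nhds 0) := by
  have hle : ∀ k, mesh 𝓑 k ≤ θ ^ k * mesh 𝓑 0 := by
    intro k
    induction k with
    | zero => simp
    | succ k ih =>
      calc mesh 𝓑 (k + 1) ≤ θ * mesh 𝓑 k := h.mesh_succ_le k (hne _)
        _ ≤ θ * (θ ^ k * mesh 𝓑 0) := by gcongr; exact hθ.1.le
        _ = θ ^ (k + 1) * mesh 𝓑 0 := by ring
  refine squeeze_zero mesh_nonneg hle ?_
  simpa using (tendsto_pow_atTop_nhds_zero_of_lt_one hθ.1.le hθ.2).mul_const (mesh 𝓑 0)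

lemma exists_mem_cover_dist_le (h : IsSubdivisionScheme f Q θ 𝓑) {y : Fin n → ℝ} {k : ℕ}
    (hy : y ∈ cover 𝓑 (k + 1)) : ∃ z ∈ cover 𝓑 k, dist (f z) y ≤ mesh 𝓑 (k + 1) := by
  obtain ⟨C, -, hU, -, hB⟩ := h.2.2 k
  obtain ⟨B, hBk, hyB⟩ := hy
  obtain ⟨-, B', hB', z, hzB, hzB'⟩ := hB.subset hBk
  exact ⟨z, hU.subset ⟨B', hB', hzB'⟩,
    (Metric.dist_le_diam_of_mem (h.1 _ B hBk).2.isBounded hzB hyB).trans (diam_le_mesh hBk)⟩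

/-- The limit set of the scheme is backward invariant. -/
lemma symm_mem_iInter_cover (h : IsSubdivisionScheme f Q θ 𝓑) (hθ : 0 < θ ∧ θ < 1)
    (hne : ∀ k, (cover 𝓑 k).Nonempty) {y : Fin n → ℝ} (hy : y ∈ ⋂ k, cover 𝓑 k) :
    f.symm y ∈ ⋂ k, cover 𝓑 k := by
  rw [Set.mem_iInter] at hy ⊢
  choose z hz hzd using fun k => h.exists_mem_cover_dist_le (hy (k + 1))
  have hfz : Filter.Tendsto (fun k => f (z k)) Filter.atTop (nhds y) :=
    tendsto_iff_dist_tendsto_zero.2 (squeeze_zero (fun _ => dist_nonneg) hzd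
      ((h.tendsto_mesh hθ hne).comp (Filter.tendsto_add_atTop_nat 1)))
  have hlim : Filter.Tendsto z Filter.atTop (nhds (f.symm y)) := by
    simpa [Function.comp_def] using (f.symm.continuous.tendsto y).comp hfz
  intro k
  refine (h.isCompact_cover k).isClosed.mem_of_tendsto hlim ?_
  filter_upwards [Filter.eventually_ge_atTop k] with m hm using h.cover_antitone hm (hz m)

lemma iInter_cover_subset (h : IsSubdivisionScheme f Q θ 𝓑) (hθ : 0 < θ ∧ θ < 1)
    (hA : IsGlobalAttractor f A) (hAQ : A ⊆ Q) : ⋂ k, cover 𝓑 k ⊆ A := by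
  obtain ⟨hAne, hAc, hAf, hattr⟩ := hA
  have hne k : (cover 𝓑 k).Nonempty := hAne.mono (h.subset_cover hAf hAQ k)
  have hback : ∀ j : ℕ, ⋂ k, cover 𝓑 k ⊆ f^[j] '' ⋂ k, cover 𝓑 k := by
    intro j
    induction j with
    | zero => simp
    | succ j ih =>
      intro y hy
      obtain ⟨x, hx, hxy⟩ := ih (h.symm_mem_iInter_cover hθ hne hy)
      exact ⟨x, hx, by rw [Function.iterate_succ_apply', hxy, f.apply_symm_apply]⟩
  have hbdd : Bornology.IsBounded (⋂ k, cover 𝓑 k) :=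
    (h.isCompact_cover 0).isBounded.subset (Set.iInter_subset _ 0)
  intro y hy
  rw [← hAc.isClosed.closure_eq, Metric.closure_eq_iInter_thickening]
  refine Set.mem_iInter₂.2 fun ε hε => ?_
  obtain ⟨N, hN⟩ := hattr _ hbdd ε hε
  exact hN N le_rfl (hback N hy)

/-- The coverings converge to the global attractor in the Hausdorff distance. -/
theorem tendsto_hausdorffDist_attractor (h : IsSubdivisionScheme f Q θ 𝓑) (hθ : 0 < θ ∧ θ < 1)
    (hA : IsGlobalAttractor f A) (hAQ : A ⊆ Q) :
    Filter.Tendsto (fun k => Metric.hausdorffDist (cover 𝓑 k) A) Filter.atTop (nhds 0) := by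
  refine Metric.tendsto_atTop.2 fun ε hε => ?_
  obtain ⟨N, hN⟩ : ∃ N, cover 𝓑 N ⊆ Metric.thickening (ε / 2) A :=
    exists_subset_nhds_of_isCompact h.cover_antitone.directed_ge h.isCompact_cover
      fun x hx => Metric.isOpen_thickening.mem_nhds
        (Metric.self_subset_thickening (half_pos hε) A (h.iInter_cover_subset hθ hA hAQ hx))
  refine ⟨N, fun k hk => ?_⟩
  rw [Real.dist_0_eq_abs, abs_of_nonneg Metric.hausdorffDist_nonneg]
  refine lt_of_le_of_lt (Metric.hausdorffDist_le_of_mem_dist (half_pos hε).le ?_ ?_)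
    (half_lt_self hε)
  · intro x hx
    obtain ⟨a, ha, hd⟩ := Metric.mem_thickening_iff.1 (hN (h.cover_antitone hk hx))
    exact ⟨a, ha, hd.le⟩
  · intro a ha
    exact ⟨a, h.subset_cover hA.2.2.1 hAQ k ha, by simpa using (half_pos hε).le⟩

end IsSubdivisionScheme

/-- Proposition 2.3: Let `f` be a homeomorphism of `ℝⁿ` with compact
global attractor `A`, and `Q¹ , Q²` compact with `A ⊆ Q¹ ⊆ Q²`. If for `i = 1, 2` the
collections `𝓑ⁱ` are generated by the subdivision scheme for `f` with initial set `Qⁱ`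
and contraction factor `0 < θᵢ < 1`, and `Q_kⁱ = ⋃_{B ∈ 𝓑_kⁱ} B`, then
`h(Q_k¹, Q_k²) → 0` in the Hausdorff distance as `k → ∞`. -/
theorem subdivision_coverings_hausdorff_close {n : ℕ}
    (f : (Fin n → ℝ) ≃ₜ (Fin n → ℝ)) (A Q₁ Q₂ : Set (Fin n → ℝ))
    (hA : IsGlobalAttractor f A)
    (hQ₁ : IsCompact Q₁) (hQ₂ : IsCompact Q₂)
    (hAQ₁ : A ⊆ Q₁) (hQ₁Q₂ : Q₁ ⊆ Q₂)
    (θ₁ θ₂ : ℝ) (hθ₁ : 0 < θ₁ ∧ θ₁ < 1) (hθ₂ : 0 < θ₂ ∧ θ₂ < 1)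
    (𝓑₁ 𝓑₂ : ℕ → Finset (Set (Fin n → ℝ)))
    (h𝓑₁ : IsSubdivisionScheme f Q₁ θ₁ 𝓑₁)
    (h𝓑₂ : IsSubdivisionScheme f Q₂ θ₂ 𝓑₂) :
    Filter.Tendsto
      (fun k => Metric.hausdorffDist
        (⋃₀ ((𝓑₁ k : Finset (Set (Fin n → ℝ))) : Set (Set (Fin n → ℝ))))
        (⋃₀ ((𝓑₂ k : Finset (Set (Fin n → ℝ))) : Set (Set (Fin n → ℝ)))))
      Filter.atTop (nhds 0) := by
  have h₁ := h𝓑₁.tendsto_hausdorffDist_attractor hθ₁ hA hAQ₁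
  have h₂ := h𝓑₂.tendsto_hausdorffDist_attractor hθ₂ hA (hAQ₁.trans hQ₁Q₂)
  refine squeeze_zero (fun _ => Metric.hausdorffDist_nonneg) (fun k => ?_)
    (by simpa using h₁.add h₂)
  rw [Metric.hausdorffDist_comm (s := IsSubdivisionScheme.cover 𝓑₂ k)]
  exact Metric.hausdorffDist_triangle (Metric.hausdorffEDist_ne_top_of_nonempty_of_bounded
    (hA.1.mono (h𝓑₁.subset_cover hA.2.2.1 hAQ₁ k)) hA.1
    (h𝓑₁.isCompact_cover k).isBounded hA.2.1.isBounded)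
end
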